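/- arXiv:2404.00993 — 7 statements merged into one kernel-verified Lean document; each statement's English description precedes it below -/
import Mathlib

section
/- As an identity of rational functions in q_1, q_2, p_1, p_2 over ℂ (with complex parameters κ_0, κ_1, κ_∞, θ_1, θ_2, α_0, s_1, s_2 satisfying s_1 ≠ s_2, s_1 ≠ 0, s_1 ≠ 1): s_1(s_1−1)H_1 = s_1(s_1−1)H_VI(q_1,p_1,s_1,κ_0,κ_1,κ_∞,θ_1,α_0) + (2q_1p_1 + q_2p_2 + 2α_0 + κ_∞)q_1q_2p_2 + (s_1(s_1−1)/(s_1−s_2))(−q_1p_1 + θ_1)q_2p_1 + (s_1(s_2−1)/(s_1−s_2))(2q_1p_1 − θ_1)q_2p_2 + (s_2(s_1−1)/(s_1−s_2))(−q_2p_2² + θ_2(p_2−p_1))q_1. -/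
noncomputable section

/-- `s₁(s₁-1)H₁`: the polynomial form of the first Hamiltonian of the
4-dimensional Garnier system, with `d = 2α₀+κ₀+κ₁+κ∞+θ₁+θ₂`. -/
def garnierH1 (k0 k1 kI t1 t2 a0 s1 s2 q1 q2 p1 p2 : ℂ) : ℂ :=
  let d := 2*a0 + k0 + k1 + kI + t1 + t2
  (q1*(q1-1)*(q1-s1) - (s1*(s1-1)/(s1-s2))*q1*q2) * p1^2
  + 2*q1*q2*(q1 + s1*(s2-1)/(s1-s2)) * p1*p2
  + q1*q2*(q2 - s2*(s1-1)/(s1-s2)) * p2^2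
  - ((k0-d)*q1*(q1-1) + k1*q1*(q1-s1) + t1*(q1-1)*(q1-s1)
      + t2*q1*(q1 + s1*(s2-1)/(s1-s2)) - t1*(s1*(s1-1)/(s1-s2))*q2) * p1
  + ((2*a0+kI)*q1*q2 + t2*q1*(s2*(s1-1)/(s1-s2)) - t1*q2*(s1*(s2-1)/(s1-s2))) * p2
  + a0*(a0+kI)*q1

/-- `s(s-1)H_VI`: the polynomial form of the Hamiltonian of the sixth
Painlevé equation. -/
def painleveVI (k0 k1 kI th a0 q p s : ℂ) : ℂ :=
  q*(q-1)*(q-s)*p^2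
  - (-(2*a0+k1+kI+th)*q*(q-1) + k1*q*(q-s) + th*(q-1)*(q-s)) * p
  + a0*(a0+kI)*q

/-- as an identity of rational functions in `q₁,q₂,p₁,p₂` over `ℂ`
(with `s₁ ≠ s₂`, `s₁ ≠ 0`, `s₁ ≠ 1`),
`s₁(s₁-1)H₁ = s₁(s₁-1)H_VI(q₁,p₁,s₁,κ₀,κ₁,κ∞,θ₁,α₀) + (correction terms)`. -/
theorem garnierH1_eq_painleveVI_plus_correction
    (k0 k1 kI t1 t2 a0 s1 s2 : ℂ)
    (hss : s1 ≠ s2) (hs0 : s1 ≠ 0) (hs1 : s1 ≠ 1) :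
    ∀ q1 q2 p1 p2 : ℂ,
      garnierH1 k0 k1 kI t1 t2 a0 s1 s2 q1 q2 p1 p2
        = painleveVI k0 k1 kI t1 a0 q1 p1 s1
          + (2*q1*p1 + q2*p2 + 2*a0 + kI)*q1*q2*p2
          + (s1*(s1-1)/(s1-s2))*(-(q1*p1) + t1)*q2*p1
          + (s1*(s2-1)/(s1-s2))*(2*q1*p1 - t1)*q2*p2
          + (s2*(s1-1)/(s1-s2))*(-(q2*p2^2) + t2*(p2-p1))*q1 := by
  intro q1 q2 p1 p2
  have h : s1 - s2 ≠ 0 := sub_ne_zero.mpr hss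
  have key : s2*(s1-1)/(s1-s2) = 1 + s1*(s2-1)/(s1-s2) := by
    field_simp
    ring
  unfold garnierH1 painleveVI
  simp only [key]
  ring
end
end

section
/- The Bäcklund transformation w_{α_0} is an involution: if (q̄_1, q̄_2, r̄_1, r̄_2) = (s_1r_1(r_1−θ_1)/(q_1R_{12}(R_{12}+κ_∞)), s_2r_2(r_2−θ_2)/(q_2R_{12}(R_{12}+κ_∞)), −r_1, −r_2) with R_{12} = r_1+r_2+α_0, and one applies the same formulas again to (q̄_1, q̄_2, r̄_1, r̄_2) with the transformed parameters (κ̄_0, κ̄_1, κ̄_∞, θ̄_1, θ̄_2, ᾱ_0) = (d−κ_0, d−κ_1, −κ_∞, −θ_1, −θ_2, −α_0) (and s̄_i = s_i), then the result is (q_1, q_2, r_1, r_2), provided all denominators involved (q_1, q_2, q̄_1, q̄_2, R_{12}, R_{12}+κ_∞) are nonzero. -/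
noncomputable section

/-- The action of the Bäcklund transformation `w_{α₀}` on the `(q,r)` variables,
with `R₁₂ = r₁ + r₂ + α₀`. -/
def wAlpha0 (kI t1 t2 a0 s1 s2 : ℂ) : ℂ × ℂ × ℂ × ℂ → ℂ × ℂ × ℂ × ℂ
  | (q1, q2, r1, r2) =>
    (s1*r1*(r1-t1)/(q1*(r1+r2+a0)*(r1+r2+a0+kI)),
     s2*r2*(r2-t2)/(q2*(r1+r2+a0)*(r1+r2+a0+kI)),
     -r1, -r2)

/-- `w_{α₀}` is an involution: applying the formulas again with
the transformed parameters `(κ̄₀,κ̄₁,κ̄∞,θ̄₁,θ̄₂,ᾱ₀) = (d-κ₀, d-κ₁, -κ∞, -θ₁, -θ₂, -α₀)`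
(and `s̄ᵢ = sᵢ`) returns `(q₁,q₂,r₁,r₂)`, provided all denominators involved
(`q₁, q₂, q̄₁, q̄₂, R₁₂, R₁₂+κ∞`) are nonzero. -/
theorem wAlpha0_involution (k0 k1 kI t1 t2 a0 s1 s2 q1 q2 r1 r2 : ℂ)
    (hq1 : q1 ≠ 0) (hq2 : q2 ≠ 0)
    (hR : r1 + r2 + a0 ≠ 0) (hRk : r1 + r2 + a0 + kI ≠ 0)
    (hqb1 : (wAlpha0 kI t1 t2 a0 s1 s2 (q1, q2, r1, r2)).1 ≠ 0)
    (hqb2 : (wAlpha0 kI t1 t2 a0 s1 s2 (q1, q2, r1, r2)).2.1 ≠ 0) :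
    wAlpha0 (-kI) (-t1) (-t2) (-a0) s1 s2
        (wAlpha0 kI t1 t2 a0 s1 s2 (q1, q2, r1, r2)) = (q1, q2, r1, r2) := by
  have key : ∀ s r t q : ℂ, q ≠ 0 →
      s*r*(r-t)/(q*(r1+r2+a0)*(r1+r2+a0+kI)) ≠ 0 →
      s*(-r)*(-r - -t)/(s*r*(r-t)/(q*(r1+r2+a0)*(r1+r2+a0+kI))
        *(-r1 + -r2 + -a0)*(-r1 + -r2 + -a0 + -kI)) = q := by
    intro s r t q hq hb
    have hN : s*r*(r-t) ≠ 0 := fun h => hb (by rw [h, zero_div])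
    have e1 : -r1 + -r2 + -a0 = -(r1+r2+a0) := by ring
    have e2 : -r1 + -r2 + -a0 + -kI = -(r1+r2+a0+kI) := by ring
    have e3 : s*(-r)*(-r - -t) = s*r*(r-t) := by ring
    rw [e2, e1, e3]
    generalize s*r*(r-t) = N at *
    generalize r1+r2+a0+kI = K at *
    generalize r1+r2+a0 = R at *
    field_simp
  simp only [wAlpha0] at hqb1 hqb2 ⊢
  rw [key s1 r1 t1 q1 hq1 hqb1, key s2 r2 t2 q2 hq2 hqb2, neg_neg, neg_neg]
end
end

section
/- The Bäcklund transformation σ_2 is an involution on the (q,r)-variables: if (q̄_1, q̄_2, r̄_1, r̄_2) = (q_1/Q_{12}, q_2/Q_{12}, r_1 − q_1R_{12}, r_2 − q_2R_{12}) with Q_{12} = q_1+q_2−1 and R_{12} = r_1+r_2+α_0, then (since σ_2 fixes α_0) applying the same formulas to (q̄_1, q̄_2, r̄_1, r̄_2) returns (q_1, q_2, r_1, r_2), provided Q_{12} ≠ 0. (In particular Q̄_{12} = 1/Q_{12} and R̄_{12} = −Q_{12}R_{12}.) -/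
noncomputable section

/-- The action of the Bäcklund transformation `σ₂` on the `(q,r)` variables,
with `Q₁₂ = q₁+q₂-1` and `R₁₂ = r₁+r₂+α₀` (the parameter `α₀` is fixed by `σ₂`). -/
def sigma2 (a0 : ℂ) : ℂ × ℂ × ℂ × ℂ → ℂ × ℂ × ℂ × ℂ
  | (q1, q2, r1, r2) =>
    (q1/(q1+q2-1), q2/(q1+q2-1),
     r1 - q1*(r1+r2+a0), r2 - q2*(r1+r2+a0))

/-- `σ₂` is an involution on the `(q,r)` variables provided
`Q₁₂ ≠ 0`; in particular `Q̄₁₂ = 1/Q₁₂` and `R̄₁₂ = -Q₁₂·R₁₂`. -/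
theorem sigma2_involution (a0 q1 q2 r1 r2 : ℂ) (hQ : q1 + q2 - 1 ≠ 0) :
    sigma2 a0 (sigma2 a0 (q1, q2, r1, r2)) = (q1, q2, r1, r2)
    ∧ (q1/(q1+q2-1) + q2/(q1+q2-1) - 1) = 1/(q1+q2-1)
    ∧ ((r1 - q1*(r1+r2+a0)) + (r2 - q2*(r1+r2+a0)) + a0)
        = -((q1+q2-1)*(r1+r2+a0)) := by
  have h1 : (q1/(q1+q2-1) + q2/(q1+q2-1) - 1) = 1/(q1+q2-1) := by
    rw [← add_div, eq_div_iff hQ, sub_mul, div_mul_cancel₀ _ hQ]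
    ring
  have h2 : ((r1 - q1*(r1+r2+a0)) + (r2 - q2*(r1+r2+a0)) + a0)
        = -((q1+q2-1)*(r1+r2+a0)) := by ring
  have h3 : ∀ q R : ℂ, q/(q1+q2-1) * -((q1+q2-1)*R) = -(q*R) := by
    intro q R
    rw [mul_neg, ← mul_assoc, div_mul_cancel₀ _ hQ]
  have h4 : ∀ q : ℂ, q/(q1+q2-1) / (1/(q1+q2-1)) = q := by
    intro q
    rw [div_div_eq_mul_div, div_one, div_mul_cancel₀ _ hQ]
  refine ⟨?_, h1, h2⟩
  simp only [sigma2]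
  rw [h1, h2, h3, h3, h4, h4]
  simp
end
end

section
/- The composition T_1 = (w_{θ_2} ∘ w_{θ_1} ∘ w_{κ_1} ∘ w_{κ_0} ∘ w_{α_0})² of the parameter actions (applying w_{α_0} first) acts on the parameter space as the translation (κ_0, κ_1, κ_∞, θ_1, θ_2, α_0, s_1, s_2) ↦ (κ_0 − 2d, κ_1 − 2d, κ_∞, θ_1, θ_2, α_0 + 2d, s_1, s_2), where d = 2α_0 + κ_0 + κ_1 + κ_∞ + θ_1 + θ_2; in particular d itself is invariant under T_1. -/
noncomputable section

/-- The parameter space `(κ₀, κ₁, κ∞, θ₁, θ₂, α₀, s₁, s₂)`. -/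
abbrev Param := ℂ × ℂ × ℂ × ℂ × ℂ × ℂ × ℂ × ℂ

/-- `d = 2α₀ + κ₀ + κ₁ + κ∞ + θ₁ + θ₂`. -/
def dOf : Param → ℂ
  | (k0, k1, kI, t1, t2, a0, _, _) => 2*a0 + k0 + k1 + kI + t1 + t2

/-- Parameter action of `w_{κ₀}`. -/
def wK0 : Param → Param
  | (k0, k1, kI, t1, t2, a0, s1, s2) => (-k0, k1, kI, t1, t2, a0 + k0, s1, s2)

/-- Parameter action of `w_{κ₁}`. -/
def wK1 : Param → Param
  | (k0, k1, kI, t1, t2, a0, s1, s2) => (k0, -k1, kI, t1, t2, a0 + k1, s1, s2)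

/-- Parameter action of `w_{θ₁}`. -/
def wT1 : Param → Param
  | (k0, k1, kI, t1, t2, a0, s1, s2) => (k0, k1, kI, -t1, t2, a0 + t1, s1, s2)

/-- Parameter action of `w_{θ₂}`. -/
def wT2 : Param → Param
  | (k0, k1, kI, t1, t2, a0, s1, s2) => (k0, k1, kI, t1, -t2, a0 + t2, s1, s2)

/-- Parameter action of `w_{α₀}`. -/
def wA0 : Param → Param
  | (k0, k1, kI, t1, t2, a0, s1, s2) =>
    let d := 2*a0 + k0 + k1 + kI + t1 + t2
    (d - k0, d - k1, -kI, -t1, -t2, -a0, s1, s2)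

/-- `w_{θ₂} ∘ w_{θ₁} ∘ w_{κ₁} ∘ w_{κ₀} ∘ w_{α₀}` (applying `w_{α₀}` first). -/
def F : Param → Param := wT2 ∘ wT1 ∘ wK1 ∘ wK0 ∘ wA0

/-- `T₁ = (w_{θ₂} ∘ w_{θ₁} ∘ w_{κ₁} ∘ w_{κ₀} ∘ w_{α₀})²`. -/
def T1 : Param → Param := F ∘ F

/-- `T₁` acts on the parameter space as the translation
`(κ₀-2d, κ₁-2d, κ∞, θ₁, θ₂, α₀+2d, s₁, s₂)`; in particular `d` is invariant. -/
theorem T1_is_translation (k0 k1 kI t1 t2 a0 s1 s2 : ℂ) :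
    T1 (k0, k1, kI, t1, t2, a0, s1, s2)
      = (k0 - 2*(2*a0 + k0 + k1 + kI + t1 + t2),
         k1 - 2*(2*a0 + k0 + k1 + kI + t1 + t2),
         kI, t1, t2,
         a0 + 2*(2*a0 + k0 + k1 + kI + t1 + t2), s1, s2)
    ∧ dOf (T1 (k0, k1, kI, t1, t2, a0, s1, s2))
        = dOf (k0, k1, kI, t1, t2, a0, s1, s2) := by
  have h : T1 (k0, k1, kI, t1, t2, a0, s1, s2)
      = (k0 - 2*(2*a0 + k0 + k1 + kI + t1 + t2),
         k1 - 2*(2*a0 + k0 + k1 + kI + t1 + t2),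
         kI, t1, t2,
         a0 + 2*(2*a0 + k0 + k1 + kI + t1 + t2), s1, s2) := by
    simp only [T1, F, wT2, wT1, wK1, wK0, wA0, Function.comp_apply, Prod.mk.injEq]
    refine ⟨?_, ?_, ?_, ?_, ?_, ?_, trivial⟩ <;> ring
  refine ⟨h, ?_⟩
  rw [h]
  simp only [dOf]
  ring
end
end

section
/- The reflection associated to α_0 does not preserve the integral lattice: w_{α_0}(H_q) := H_q − 2(⟨H_q, α̌_0⟩/⟨α_0, α̌_0⟩)α_0 = H_q + (4/5)α_0 = (7/5)H_q + (4/5)H_r − (4/5)(E_1 + E_3 + E_5), which does not lie in the ℤ-submodule L of L⊗ℚ spanned by H_q, H_r, E_1, …, E_10. -/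
noncomputable section

/-- `L ⊗ ℚ`, with coordinates in the basis `H_q, H_r, E_1, …, E_10`
(index `0 ↔ H_q`, `1 ↔ H_r`, `k+1 ↔ E_k`). -/
abbrev LQ := Fin 12 → ℚ

/-- `M ⊗ ℚ`, with coordinates in the basis `h_q, h_r, e_1, …, e_10`. -/
abbrev MQ := Fin 12 → ℚ

/-- The basis vector `H_q` of `L`. -/
def Hq : LQ := Pi.single 0 1
/-- The basis vector `H_r` of `L`. -/
def Hr : LQ := Pi.single 1 1
/-- The basis vector `E_{k+1}` of `L` (`k : Fin 10` is 0-based, so `E 0 = E_1`). -/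
def E (k : Fin 10) : LQ := Pi.single k.succ.succ 1
/-- The basis vector `h_q` of `M`. -/
def hq : MQ := Pi.single 0 1
/-- The basis vector `h_r` of `M`. -/
def hr : MQ := Pi.single 1 1
/-- The basis vector `e_{k+1}` of `M` (`e 0 = e_1`). -/
def e (k : Fin 10) : MQ := Pi.single k.succ.succ 1

/-- The intersection pairing: `⟨H_q,h_q⟩ = ⟨H_r,h_r⟩ = 1`, `⟨E_k,e_l⟩ = -δ_{kl}`,
all other pairings of basis vectors zero, extended `ℚ`-bilinearly. -/
def pair (D : LQ) (d : MQ) : ℚ :=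
  D 0 * d 0 + D 1 * d 1 - ∑ k : Fin 10, D k.succ.succ * d k.succ.succ

/-- The roots `α₀, α₁, …, α₅`. -/
def root : Fin 6 → LQ :=
  ![(1/2 : ℚ) • (Hq + 2 • Hr - 2 • E 0 - 2 • E 2 - 2 • E 4),
    Hq - E 8 - E 9,
    Hq - E 6 - E 7,
    E 4 - E 5,
    E 0 - E 1,
    E 2 - E 3]

/-- The coroots `α̌₀, α̌₁, …, α̌₅`. -/
def coroot : Fin 6 → MQ :=
  ![hq - e 0 - e 2 - e 4,
    hr - e 8 - e 9,
    hr - e 6 - e 7,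
    e 4 - e 5,
    e 0 - e 1,
    e 2 - e 3]

/-- The null root `δ = 3H_q + 2H_r - (E_1 + ⋯ + E_10)`. -/
def nullRoot : LQ := 3 • Hq + 2 • Hr - ∑ k : Fin 10, E k

/-- The null coroot `δ̌ = 2h_q + 2h_r - (e_1 + ⋯ + e_10)`. -/
def nullCoroot : MQ := 2 • hq + 2 • hr - ∑ k : Fin 10, e k

/-- the reflection associated to `α₀` does not preserve the
integral lattice: `w_{α₀}(H_q) = H_q - 2(⟨H_q,α̌₀⟩/⟨α₀,α̌₀⟩)α₀ = H_q + (4/5)α₀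
= (7/5)H_q + (4/5)H_r - (4/5)(E_1+E_3+E_5)`, which does not lie in the
`ℤ`-submodule of `L ⊗ ℚ` spanned by `H_q, H_r, E_1, …, E_10`. -/
theorem alpha0_reflection_not_integral :
    Hq - (2 * (pair Hq (coroot 0) / pair (root 0) (coroot 0))) • root 0
      = Hq + (4/5 : ℚ) • root 0
    ∧ Hq + (4/5 : ℚ) • root 0
      = (7/5 : ℚ) • Hq + (4/5 : ℚ) • Hr - (4/5 : ℚ) • (E 0 + E 2 + E 4)
    ∧ Hq + (4/5 : ℚ) • root 0
        ∉ Submodule.span ℤ (Set.range fun i : Fin 12 => (Pi.single i 1 : LQ)) := by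
  have hc : coroot 0 = ![1, 0, -1, 0, -1, 0, -1, 0, 0, 0, 0, 0] := by
    ext i
    fin_cases i <;> simp [coroot, hq, e, Fin.ext_iff]
  have hH : Hq = ![1, 0, 0, 0, 0, 0, 0, 0, 0, 0, 0, 0] := by
    ext i
    fin_cases i <;> simp [Hq, Fin.ext_iff]
  have hr0 : root 0 = ![1/2, 1, -1, 0, -1, 0, -1, 0, 0, 0, 0, 0] := by
    ext i
    fin_cases i <;> simp [root, Hq, Hr, E, Fin.ext_iff]
  have h1 : pair Hq (coroot 0) = 1 := by
    rw [hc, hH]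
    simp only [pair, Fin.sum_univ_succ]
    simp
  have h2 : pair (root 0) (coroot 0) = -5/2 := by
    rw [hc, hr0]
    simp only [pair, Fin.sum_univ_succ]
    simp
    norm_num
  have h3 : Hq + (4/5 : ℚ) • root 0
      = (7/5 : ℚ) • Hq + (4/5 : ℚ) • Hr - (4/5 : ℚ) • (E 0 + E 2 + E 4) := by
    simp only [root, Matrix.cons_val_zero]
    module
  refine ⟨?_, h3, ?_⟩
  · rw [h1, h2]
    module
  · intro h
    have key : ∀ v ∈ Submodule.span ℤ (Set.range fun i : Fin 12 => (Pi.single i 1 : LQ)),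
        ∃ n : ℤ, v 0 = n := by
      intro v hv
      induction hv using Submodule.span_induction with
      | mem x hx =>
        obtain ⟨i, rfl⟩ := hx
        by_cases hi : i = 0
        · exact ⟨1, by simp [hi]⟩
        · exact ⟨0, by simp [Ne.symm hi]⟩
      | zero => exact ⟨0, by simp⟩
      | add x y _ _ hx hy =>
        obtain ⟨a, ha⟩ := hx
        obtain ⟨b, hb⟩ := hy
        exact ⟨a + b, by simp [ha, hb]⟩
      | smul c x _ hx =>
        obtain ⟨a, ha⟩ := hx
        exact ⟨c * a, by simp [ha]⟩
    obtain ⟨n, hn⟩ := key _ h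
    rw [h3] at hn
    have h4 : (7/5 : ℚ) = n := by
      rw [← hn]
      simp [Hq, Hr, E, Fin.ext_iff]
    have h5 : (7 : ℚ) = 5 * n := by linarith
    have h6 : (7 : ℤ) = 5 * n := by exact_mod_cast h5
    omega
end
end

section
/- The composition T := T_{−α_1} ∘ T_{−α_2} ∘ T_{−α_3} ∘ T_{−α_4} ∘ T_{−α_5} (which realizes T_{α_0}²) acts on the roots by T(α_0) = α_0 + 5δ and T(α_i) = α_i − 2δ for i = 1, …, 5; i.e., it adds δ times the vector (5, −2, −2, −2, −2, −2). -/
noncomputable section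

/-- Kac's translation `T_{αᵢ} : D ↦ D + ⟨D,δ̌⟩αᵢ + ⟨D, δ̌ - α̌ᵢ⟩δ`. -/
def Tpos (i : Fin 6) (D : LQ) : LQ :=
  D + pair D nullCoroot • root i + pair D (nullCoroot - coroot i) • nullRoot

/-- The inverse translation `T_{-αᵢ} : D ↦ D - ⟨D,δ̌⟩αᵢ + ⟨D, δ̌ + α̌ᵢ⟩δ`. -/
def Tneg (i : Fin 6) (D : LQ) : LQ :=
  D - pair D nullCoroot • root i + pair D (nullCoroot + coroot i) • nullRoot

/-- `T = T_{-α₁} ∘ T_{-α₂} ∘ T_{-α₃} ∘ T_{-α₄} ∘ T_{-α₅}` (realizing `T_{α₀}²`). -/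
def T : LQ → LQ := Tneg 1 ∘ Tneg 2 ∘ Tneg 3 ∘ Tneg 4 ∘ Tneg 5

theorem pair_add_smul (D N : LQ) (c : ℚ) (d : MQ) :
    pair (D + c • N) d = pair D d + c * pair N d := by
  simp only [pair, Pi.add_apply, Pi.smul_apply, smul_eq_mul, add_mul, Finset.sum_add_distrib,
    mul_assoc, ← Finset.mul_sum]
  ring

theorem pair_add_right (D : LQ) (d d' : MQ) :
    pair D (d + d') = pair D d + pair D d' := by
  simp only [pair, Pi.add_apply, mul_add, Finset.sum_add_distrib]
  ring

/-- Coordinates of the null root. -/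
theorem nullRoot_eq : nullRoot = ![3, 2, -1, -1, -1, -1, -1, -1, -1, -1, -1, -1] := by
  funext k
  fin_cases k <;> simp [nullRoot, Hq, Hr, E, Fin.sum_univ_succ, Fin.ext_iff]

/-- Coordinates of the null coroot. -/
theorem nullCoroot_eq : nullCoroot = ![2, 2, -1, -1, -1, -1, -1, -1, -1, -1, -1, -1] := by
  funext k
  fin_cases k <;> simp [nullCoroot, hq, hr, e, Fin.sum_univ_succ, Fin.ext_iff]

theorem pair_null_null : pair nullRoot nullCoroot = 0 := by
  rw [nullRoot_eq, nullCoroot_eq]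
  simp [pair, Fin.sum_univ_succ]
  norm_num

/-- Coordinates of the roots. -/
theorem root_eq : root =
    ![![1/2, 1, -1, 0, -1, 0, -1, 0, 0, 0, 0, 0],
      ![1, 0, 0, 0, 0, 0, 0, 0, 0, 0, -1, -1],
      ![1, 0, 0, 0, 0, 0, 0, 0, -1, -1, 0, 0],
      ![0, 0, 0, 0, 0, 0, 1, -1, 0, 0, 0, 0],
      ![0, 0, 1, -1, 0, 0, 0, 0, 0, 0, 0, 0],
      ![0, 0, 0, 0, 1, -1, 0, 0, 0, 0, 0, 0]] := by
  funext i k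
  fin_cases i <;> fin_cases k <;> simp [root, Hq, Hr, E, Pi.single_apply, Fin.ext_iff]

/-- Coordinates of the coroots. -/
theorem coroot_eq : coroot =
    ![![1, 0, -1, 0, -1, 0, -1, 0, 0, 0, 0, 0],
      ![0, 1, 0, 0, 0, 0, 0, 0, 0, 0, -1, -1],
      ![0, 1, 0, 0, 0, 0, 0, 0, -1, -1, 0, 0],
      ![0, 0, 0, 0, 0, 0, 1, -1, 0, 0, 0, 0],
      ![0, 0, 1, -1, 0, 0, 0, 0, 0, 0, 0, 0],
      ![0, 0, 0, 0, 1, -1, 0, 0, 0, 0, 0, 0]] := by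
  funext i k
  fin_cases i <;> fin_cases k <;> simp [coroot, hq, hr, e, Pi.single_apply, Fin.ext_iff]

theorem pair_root_null (i : Fin 6) : pair (root i) nullCoroot = 0 := by
  rw [nullCoroot_eq, root_eq]
  fin_cases i <;> simp [pair, Fin.sum_univ_succ] <;> norm_num

theorem pair_null_coroot (i : Fin 6) (hi : i ≠ 0) : pair nullRoot (coroot i) = 0 := by
  rw [nullRoot_eq, coroot_eq]
  fin_cases i <;> first | exact absurd rfl hi | (simp [pair, Fin.sum_univ_succ] <;> norm_num)

theorem pair_root_zero (j : Fin 6) (hj : j ≠ 0) : pair (root 0) (coroot j) = 1 := by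
  rw [root_eq, coroot_eq]
  fin_cases j <;> first | exact absurd rfl hj | (simp [pair, Fin.sum_univ_succ] <;> norm_num)

theorem pair_root_root (i j : Fin 6) (hi : i ≠ 0) (hj : j ≠ 0) :
    pair (root i) (coroot j) = if i = j then -2 else 0 := by
  rw [root_eq, coroot_eq]
  fin_cases i <;> fin_cases j <;>
    first
    | exact absurd rfl hi
    | exact absurd rfl hj
    | (simp [pair, Fin.sum_univ_succ] <;> norm_num)

theorem Tneg_shift (i j : Fin 6) (hj : j ≠ 0) (c : ℚ) :
    Tneg j (root i + c • nullRoot) =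
      root i + (c + pair (root i) (coroot j)) • nullRoot := by
  simp only [Tneg, pair_add_smul, pair_add_right, pair_root_null, pair_null_null,
    pair_null_coroot j hj]
  module

theorem T_root (i : Fin 6) :
    T (root i) = root i + (pair (root i) (coroot 5) + pair (root i) (coroot 4)
      + pair (root i) (coroot 3) + pair (root i) (coroot 2)
      + pair (root i) (coroot 1)) • nullRoot := by
  have h : root i = root i + (0 : ℚ) • nullRoot := by simp
  conv_lhs => rw [h]
  simp only [T, Function.comp]
  rw [Tneg_shift i 5 (by decide), Tneg_shift i 4 (by decide), Tneg_shift i 3 (by decide),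
    Tneg_shift i 2 (by decide), Tneg_shift i 1 (by decide), zero_add]

/-- `T` acts on the roots by `T(α₀) = α₀ + 5δ` and
`T(αᵢ) = αᵢ - 2δ` for `i = 1,…,5`. -/
theorem T_alpha0_squared_on_roots :
    T (root 0) = root 0 + 5 • nullRoot
    ∧ ∀ i : Fin 6, i ≠ 0 → T (root i) = root i - 2 • nullRoot := by
  refine ⟨?_, ?_⟩
  · rw [T_root]
    simp only [pair_root_zero _ (show (5 : Fin 6) ≠ 0 by decide),
      pair_root_zero _ (show (4 : Fin 6) ≠ 0 by decide),
      pair_root_zero _ (show (3 : Fin 6) ≠ 0 by decide),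
      pair_root_zero _ (show (2 : Fin 6) ≠ 0 by decide),
      pair_root_zero _ (show (1 : Fin 6) ≠ 0 by decide)]
    module
  · intro i hi
    rw [T_root, pair_root_root i 5 hi (by decide), pair_root_root i 4 hi (by decide),
      pair_root_root i 3 hi (by decide), pair_root_root i 2 hi (by decide),
      pair_root_root i 1 hi (by decide)]
    have h : ((if i = 5 then -2 else 0) + (if i = 4 then -2 else 0) + (if i = 3 then -2 else 0)
        + (if i = 2 then -2 else 0) + (if i = 1 then -2 else 0) : ℚ) = -2 := by
      fin_cases i <;> simp at hi ⊢
    rw [h]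
    module
end
end

section
/- The (q,r)-form of the Bäcklund transformations is conjugate to the (q,p)-form under r_i = q_ip_i: for w ∈ {w_{κ_0}, w_{α_0}, σ_2, σ_3}, if (q̄_1, q̄_2, p̄_1, p̄_2) is the image of (q_1, q_2, p_1, p_2) under the (q,p)-action and (q̃_1, q̃_2, r̃_1, r̃_2) is the image of (q_1, q_2, q_1p_1, q_2p_2) under the (q,r)-action, then q̃_i = q̄_i and r̃_i = q̄_ip̄_i for i = 1, 2, wherever all expressions are defined (in particular P_{12} evaluated at r_i = q_ip_i equals R_{12}). -/
noncomputable section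

/-- `(q,p)`-action of `w_{κ₀}`, with `Q₁₂ˢ = q₁/s₁+q₂/s₂-1`. -/
def wK0qp (k0 s1 s2 : ℂ) : ℂ × ℂ × ℂ × ℂ → ℂ × ℂ × ℂ × ℂ
  | (q1, q2, p1, p2) =>
    (q1, q2, p1 - k0/(s1*(q1/s1 + q2/s2 - 1)), p2 - k0/(s2*(q1/s1 + q2/s2 - 1)))

/-- `(q,r)`-action of `w_{κ₀}`. -/
def wK0qr (k0 s1 s2 : ℂ) : ℂ × ℂ × ℂ × ℂ → ℂ × ℂ × ℂ × ℂ
  | (q1, q2, r1, r2) =>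
    (q1, q2, r1 - k0*q1/(s1*(q1/s1 + q2/s2 - 1)), r2 - k0*q2/(s2*(q1/s1 + q2/s2 - 1)))

/-- `(q,p)`-action of `w_{α₀}`, with `P₁₂ = q₁p₁+q₂p₂+α₀` and
`q̄ᵢ` the first two components. -/
def wA0qp (kI t1 t2 a0 s1 s2 : ℂ) : ℂ × ℂ × ℂ × ℂ → ℂ × ℂ × ℂ × ℂ
  | (q1, q2, p1, p2) =>
    (s1*p1*(q1*p1-t1)/((q1*p1+q2*p2+a0)*(q1*p1+q2*p2+a0+kI)),
     s2*p2*(q2*p2-t2)/((q1*p1+q2*p2+a0)*(q1*p1+q2*p2+a0+kI)),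
     -(q1*p1)/(s1*p1*(q1*p1-t1)/((q1*p1+q2*p2+a0)*(q1*p1+q2*p2+a0+kI))),
     -(q2*p2)/(s2*p2*(q2*p2-t2)/((q1*p1+q2*p2+a0)*(q1*p1+q2*p2+a0+kI))))

/-- `(q,r)`-action of `w_{α₀}`, with `R₁₂ = r₁+r₂+α₀`. -/
def wA0qr (kI t1 t2 a0 s1 s2 : ℂ) : ℂ × ℂ × ℂ × ℂ → ℂ × ℂ × ℂ × ℂ
  | (q1, q2, r1, r2) =>
    (s1*r1*(r1-t1)/(q1*(r1+r2+a0)*(r1+r2+a0+kI)),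
     s2*r2*(r2-t2)/(q2*(r1+r2+a0)*(r1+r2+a0+kI)),
     -r1, -r2)

/-- `(q,p)`-action of `σ₂`, with `Q₁₂ = q₁+q₂-1`, `P₁₂ = q₁p₁+q₂p₂+α₀`. -/
def sig2qp (a0 : ℂ) : ℂ × ℂ × ℂ × ℂ → ℂ × ℂ × ℂ × ℂ
  | (q1, q2, p1, p2) =>
    (q1/(q1+q2-1), q2/(q1+q2-1),
     (q1+q2-1)*(p1 - (q1*p1+q2*p2+a0)), (q1+q2-1)*(p2 - (q1*p1+q2*p2+a0)))

/-- `(q,r)`-action of `σ₂`, with `R₁₂ = r₁+r₂+α₀`. -/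
def sig2qr (a0 : ℂ) : ℂ × ℂ × ℂ × ℂ → ℂ × ℂ × ℂ × ℂ
  | (q1, q2, r1, r2) =>
    (q1/(q1+q2-1), q2/(q1+q2-1), r1 - q1*(r1+r2+a0), r2 - q2*(r1+r2+a0))

/-- `(q,p)`-action of `σ₃`. -/
def sig3qp (a0 : ℂ) : ℂ × ℂ × ℂ × ℂ → ℂ × ℂ × ℂ × ℂ
  | (q1, q2, p1, p2) =>
    (1/q1, -q2/q1, -(q1*(q1*p1+q2*p2+a0)), -(q1*p2))

/-- `(q,r)`-action of `σ₃`. -/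
def sig3qr (a0 : ℂ) : ℂ × ℂ × ℂ × ℂ → ℂ × ℂ × ℂ × ℂ
  | (q1, q2, r1, r2) => (1/q1, -q2/q1, -(r1+r2+a0), r2)

/-- The conjugation property under `rᵢ = qᵢpᵢ`: the `(q,r)`-image of
`(q₁,q₂,q₁p₁,q₂p₂)` is `(q̄₁, q̄₂, q̄₁p̄₁, q̄₂p̄₂)` where `(q̄₁,q̄₂,p̄₁,p̄₂)` is the
`(q,p)`-image of `(q₁,q₂,p₁,p₂)`. -/
def Conjugate (fqp fqr : ℂ × ℂ × ℂ × ℂ → ℂ × ℂ × ℂ × ℂ) (q1 q2 p1 p2 : ℂ) : Prop :=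
  fqr (q1, q2, q1*p1, q2*p2)
    = ((fqp (q1, q2, p1, p2)).1,
       (fqp (q1, q2, p1, p2)).2.1,
       (fqp (q1, q2, p1, p2)).1 * (fqp (q1, q2, p1, p2)).2.2.1,
       (fqp (q1, q2, p1, p2)).2.1 * (fqp (q1, q2, p1, p2)).2.2.2)

/-- for `w ∈ {w_{κ₀}, w_{α₀}, σ₂, σ₃}` the `(q,r)`-form of the
Bäcklund transformation is conjugate to the `(q,p)`-form under `rᵢ = qᵢpᵢ`,
wherever all expressions are defined; in particular `P₁₂` evaluated at
`rᵢ = qᵢpᵢ` equals `R₁₂`. -/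
theorem qr_form_conjugate_to_qp_form (k0 kI t1 t2 a0 s1 s2 q1 q2 p1 p2 : ℂ) :
    (s1 ≠ 0 → s2 ≠ 0 → q1/s1 + q2/s2 - 1 ≠ 0 →
      Conjugate (wK0qp k0 s1 s2) (wK0qr k0 s1 s2) q1 q2 p1 p2)
    ∧ (q1 ≠ 0 → q2 ≠ 0 →
        q1*p1 + q2*p2 + a0 ≠ 0 → q1*p1 + q2*p2 + a0 + kI ≠ 0 →
        (wA0qp kI t1 t2 a0 s1 s2 (q1, q2, p1, p2)).1 ≠ 0 →
        (wA0qp kI t1 t2 a0 s1 s2 (q1, q2, p1, p2)).2.1 ≠ 0 →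
      Conjugate (wA0qp kI t1 t2 a0 s1 s2) (wA0qr kI t1 t2 a0 s1 s2) q1 q2 p1 p2)
    ∧ (q1 + q2 - 1 ≠ 0 → Conjugate (sig2qp a0) (sig2qr a0) q1 q2 p1 p2)
    ∧ (q1 ≠ 0 → Conjugate (sig3qp a0) (sig3qr a0) q1 q2 p1 p2)
    ∧ (q1*p1 + q2*p2 + a0 = (q1*p1) + (q2*p2) + a0) := by
  refine ⟨?_, ?_, ?_, ?_, rfl⟩
  · intro h1 h2 h3
    simp only [Conjugate, wK0qp, wK0qr, Prod.mk.injEq, true_and]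
    constructor <;> ring
  · intro h1 h2 h3 h4 h5 h6
    simp only [wA0qp] at h5 h6
    simp only [Conjugate, wA0qp, wA0qr, Prod.mk.injEq]
    refine ⟨?_, ?_, (mul_div_cancel₀ _ h5).symm, (mul_div_cancel₀ _ h6).symm⟩
    · field_simp
    · field_simp
  · intro h
    simp only [Conjugate, sig2qp, sig2qr, Prod.mk.injEq, true_and]
    constructor <;> field_simp
  · intro h
    simp only [Conjugate, sig3qp, sig3qr, Prod.mk.injEq, true_and]
    constructor <;> field_simp
end
end
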